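/- If I = [k/L^n, (k+1)/L^n] ⊂ [0,1] with k, n nonnegative integers and L a power of 2, then F_W(1_I)(y) = L^{-n} W_k(y/L^n) for y ∈ [0, L^n). -/

import Mathlib

open MeasureTheory Set

noncomputable section

/-- The binary digit of `x ≥ 0` in position `k` (the coefficient of `2^k` in the binary
expansion `x = ∑_k x_k 2^k`). -/
def rbit (x : ℝ) (k : ℤ) : ℕ := (⌊x / (2:ℝ) ^ k⌋ % 2).toNat

/-- The `k`-th binary digit of the dyadic convolution product:
`c_k = ∑_{j ∈ ℤ} x_j y_{k-j} (mod 2)` (the sum is always finite). -/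
def dprodDigit (x y : ℝ) (k : ℤ) : ℕ :=
  {j : ℤ | rbit x j = 1 ∧ rbit y (k - j) = 1}.ncard % 2

/-- The dyadic convolution product `x ⊗ y := ∑_k c_k 2^k`. -/
def dprod (x y : ℝ) : ℝ := ∑' k : ℤ, (dprodDigit x y k : ℝ) * (2:ℝ) ^ k

/-- The Walsh exponential `e_W(x) = (-1)^{x_{-1}}`, where `x_{-1}` is the first binary
digit of `x` after the point. -/
def eW (x : ℝ) : ℝ := (-1 : ℝ) ^ rbit x (-1)

/-- The Walsh transform `F_W f(y) = ∫_{[0,∞)} e_W(x ⊗ y) f(x) dx`. -/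
def walshTransform (f : ℝ → ℂ) (y : ℝ) : ℂ :=
  ∫ x in Set.Ici (0:ℝ), (eW (dprod x y) : ℂ) * f x

/-- `x` is a dyadic rational. -/
def IsDyadic (x : ℝ) : Prop := ∃ (n : ℤ) (k : ℕ), x = (n : ℝ) / 2 ^ k
/-- The Walsh functions, defined recursively; `W n` vanishes outside `[0,1)`. -/
def walsh : ℕ → ℝ → ℝ
  | 0 => fun x => if 0 ≤ x ∧ x < 1 then 1 else 0
  | (n+1) => fun x =>
      if (n+1) % 2 = 0 then walsh ((n+1)/2) (2*x) + walsh ((n+1)/2) (2*x-1)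
      else walsh ((n+1)/2) (2*x) - walsh ((n+1)/2) (2*x-1)
  termination_by n => n
  decreasing_by all_goals exact Nat.div_lt_self (Nat.succ_pos n) one_lt_two

theorem rbit_eq_ite (x : ℝ) (k : ℤ) : rbit x k = if ⌊x / (2:ℝ) ^ k⌋ % 2 = 1 then 1 else 0 := by
  unfold rbit
  split_ifs with h
  · simp [h]
  · have h0 : ⌊x / (2:ℝ) ^ k⌋ % 2 = 0 := by omega
    simp [h0]

theorem rbit_eq_one_iff {x : ℝ} {k : ℤ} : rbit x k = 1 ↔ ⌊x / (2:ℝ) ^ k⌋ % 2 = 1 := by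
  simp [rbit_eq_ite]

theorem rbit_eq_zero_of_lt {x : ℝ} {k : ℤ} (h0 : 0 ≤ x) (h : x < (2:ℝ) ^ k) : rbit x k = 0 := by
  have : ⌊x / (2:ℝ) ^ k⌋ = 0 := by
    rw [Int.floor_eq_zero_iff]
    exact ⟨by positivity, (div_lt_one (by positivity)).2 h⟩
  simp [rbit, this]

theorem le_zpow_of_rbit_eq_one {x : ℝ} {k : ℤ} (h0 : 0 ≤ x) (h : rbit x k = 1) :
    (2:ℝ) ^ k ≤ x := by
  by_contra! hlt
  simp [rbit_eq_zero_of_lt h0 hlt] at h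

theorem le_log_of_rbit_eq_one {x : ℝ} {k : ℤ} (h0 : 0 ≤ x) (h : rbit x k = 1) :
    k ≤ Int.log 2 x := by
  have h2 := le_zpow_of_rbit_eq_one h0 h
  have hx : 0 < x := lt_of_lt_of_le (by positivity) h2
  exact (Int.zpow_le_iff_le_log one_lt_two hx).1 (by exact_mod_cast h2)

theorem rbit_log_eq_one {y : ℝ} (hy : 0 < y) : rbit y (Int.log 2 y) = 1 := by
  have h1 : (2:ℝ) ^ Int.log 2 y ≤ y := by
    exact_mod_cast Int.zpow_log_le_self (b := 2) one_lt_two hy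
  have h2 : y < (2:ℝ) ^ (Int.log 2 y + 1) := by
    exact_mod_cast Int.lt_zpow_succ_log_self (b := 2) one_lt_two y
  have hp : (0:ℝ) < (2:ℝ) ^ Int.log 2 y := by positivity
  have : ⌊y / (2:ℝ) ^ Int.log 2 y⌋ = 1 := by
    rw [Int.floor_eq_iff]
    rw [zpow_add_one₀ two_ne_zero] at h2
    constructor
    · rw [le_div_iff₀ hp]; simpa using h1
    · rw [div_lt_iff₀ hp]; push_cast; linarith
  simp [rbit, this]

theorem floor_div_two_zpow_add (x : ℝ) (i : ℤ) (n : ℕ) :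
    ⌊x / (2:ℝ) ^ (i + n)⌋ = ⌊x / (2:ℝ) ^ i⌋ / 2 ^ n := by
  have := Int.floor_div_natCast (x / (2:ℝ) ^ i) (2 ^ n)
  push_cast at this
  rw [← this, zpow_add₀ two_ne_zero, zpow_natCast, div_div]

theorem rbit_congr_of_floor_eq {x x' : ℝ} {i j : ℤ}
    (h : ⌊x / (2:ℝ) ^ i⌋ = ⌊x' / (2:ℝ) ^ i⌋) (hij : i ≤ j) : rbit x j = rbit x' j := by
  obtain ⟨n, rfl⟩ := Int.le.dest hij
  simp only [rbit, floor_div_two_zpow_add, h]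

theorem floor_eq_of_floor_eq_of_rbit_eq {x x' : ℝ} {i : ℤ}
    (h : ⌊x / (2:ℝ) ^ i⌋ = ⌊x' / (2:ℝ) ^ i⌋) (hr : rbit x (i - 1) = rbit x' (i - 1)) :
    ⌊x / (2:ℝ) ^ (i - 1)⌋ = ⌊x' / (2:ℝ) ^ (i - 1)⌋ := by
  have hx := floor_div_two_zpow_add x (i - 1) 1
  have hx' := floor_div_two_zpow_add x' (i - 1) 1
  simp only [Nat.cast_one, sub_add_cancel, pow_one] at hx hx'
  simp only [rbit] at hr
  omega

theorem eq_of_forall_floor_eq {x x' : ℝ} {i : ℤ}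
    (h : ∀ n : ℕ, ⌊x / (2:ℝ) ^ (i - n)⌋ = ⌊x' / (2:ℝ) ^ (i - n)⌋) : x = x' := by
  by_contra hne
  have hpos : 0 < |x - x'| / 2 ^ i := div_pos (abs_pos.2 (sub_ne_zero.2 hne)) (by positivity)
  obtain ⟨n, hn⟩ := exists_pow_lt_of_lt_one hpos (by norm_num : (1 / 2 : ℝ) < 1)
  have h1 := Int.abs_sub_lt_one_of_floor_eq_floor (h n)
  rw [← sub_div, abs_div, abs_of_pos (by positivity : (0:ℝ) < 2 ^ (i - n)),
    div_lt_one (by positivity), zpow_sub₀ two_ne_zero, zpow_natCast] at h1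
  rw [lt_div_iff₀ (by positivity)] at hn
  rw [one_div, inv_pow] at hn
  have : (2:ℝ) ^ i / 2 ^ n = (2 ^ n)⁻¹ * 2 ^ i := by field_simp
  linarith

/-- The positions contributing to the `k`-th digit of `x ⊗ y`. -/
def dprodSupport (x y : ℝ) (k : ℤ) : Set ℤ := {j : ℤ | rbit x j = 1 ∧ rbit y (k - j) = 1}

theorem dprodDigit_eq (x y : ℝ) (k : ℤ) : dprodDigit x y k = (dprodSupport x y k).ncard % 2 := rfl

theorem dprodSupport_subset {x y : ℝ} (hx : 0 ≤ x) (hy : 0 ≤ y) (k : ℤ) :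
    dprodSupport x y k ⊆ Icc (k - Int.log 2 y) (Int.log 2 x) := by
  rintro j ⟨h1, h2⟩
  have := le_log_of_rbit_eq_one hx h1
  have := le_log_of_rbit_eq_one hy h2
  exact ⟨by omega, by omega⟩

theorem finite_dprodSupport {x y : ℝ} (hx : 0 ≤ x) (hy : 0 ≤ y) (k : ℤ) :
    (dprodSupport x y k).Finite :=
  (finite_Icc _ _).subset (dprodSupport_subset hx hy k)

theorem dprodDigit_eq_zero_of_lt {x y : ℝ} (hx : 0 ≤ x) (hy : 0 ≤ y) {k : ℤ}
    (hk : Int.log 2 x + Int.log 2 y < k) : dprodDigit x y k = 0 := by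
  have : dprodSupport x y k = ∅ := by
    rw [← subset_empty_iff, ← Icc_eq_empty (a := k - Int.log 2 y) (b := Int.log 2 x) (by omega)]
    exact dprodSupport_subset hx hy k
  simp [dprodDigit_eq, this]

theorem dprodDigit_ne_of_rbit_ne {x x' y : ℝ} (hx : 0 ≤ x) (hx' : 0 ≤ x') (hy : 0 < y) {i : ℤ}
    (h : ⌊x / (2:ℝ) ^ i⌋ = ⌊x' / (2:ℝ) ^ i⌋) (h1 : rbit x (i - 1) = 1)
    (h0 : rbit x' (i - 1) ≠ 1) :
    dprodDigit x y (i - 1 + Int.log 2 y) ≠ dprodDigit x' y (i - 1 + Int.log 2 y) := by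
  have hS : dprodSupport x y (i - 1 + Int.log 2 y) =
      insert (i - 1) (dprodSupport x' y (i - 1 + Int.log 2 y)) := by
    ext j
    by_cases hj : j = i - 1
    · subst hj
      simp [dprodSupport, h1, rbit_log_eq_one hy]
    · simp only [mem_insert_iff, hj, false_or]
      rcases lt_or_ge j i with hji | hji
      · have key : ∀ z : ℝ, 0 ≤ z → j ∉ dprodSupport z y (i - 1 + Int.log 2 y) := fun z hz hm => by
          have := (dprodSupport_subset hz hy.le _ hm).1
          omega
        simp [key x hx, key x' hx']
      · simp [dprodSupport, rbit_congr_of_floor_eq h hji]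
  rw [dprodDigit_eq, dprodDigit_eq, hS,
    ncard_insert_of_notMem (fun hm => h0 hm.1) (finite_dprodSupport hx' hy.le _)]
  omega

/-- The digits of `x` above a fixed position determine `x`, once all low digits of `x ⊗ y`
are known. -/
theorem countable_setOf_dprodDigit_eq_one {y : ℝ} (hy : 0 < y) (K : ℤ) :
    {x : ℝ | 0 ≤ x ∧ ∀ k ≤ K, dprodDigit x y k = 1}.Countable := by
  set i : ℤ := K - Int.log 2 y + 1
  refine MapsTo.countable_of_injOn (f := fun x : ℝ => ⌊x / (2:ℝ) ^ i⌋) (t := univ)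
    (fun _ _ => mem_univ _) ?_ (to_countable _)
  rintro x ⟨hx, hxd⟩ x' ⟨hx', hxd'⟩ hxx'
  refine eq_of_forall_floor_eq (i := i) fun n => ?_
  induction n with
  | zero => simpa using hxx'
  | succ n ih =>
    have hd : dprodDigit x y (i - n - 1 + Int.log 2 y) =
        dprodDigit x' y (i - n - 1 + Int.log 2 y) := by
      rw [hxd _ (by omega), hxd' _ (by omega)]
    have hr : rbit x (i - n - 1) = rbit x' (i - n - 1) := by
      by_cases h1 : rbit x (i - n - 1) = 1 <;> by_cases h2 : rbit x' (i - n - 1) = 1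
      · rw [h1, h2]
      · exact absurd hd (dprodDigit_ne_of_rbit_ne hx hx' hy ih h1 h2)
      · exact absurd hd.symm (dprodDigit_ne_of_rbit_ne hx' hx hy ih.symm h2 h1)
      · rw [rbit_eq_one_iff] at h1 h2
        rw [rbit_eq_ite, rbit_eq_ite, if_neg h1, if_neg h2]
    have := floor_eq_of_floor_eq_of_rbit_eq ih hr
    rwa [show i - ((n + 1 : ℕ) : ℤ) = i - n - 1 by push_cast; ring]

theorem rbit_tsum_digits {c : ℤ → ℕ} {B : ℕ} (hc : ∀ k, c k ≤ 1) (hB : ∀ k : ℤ, B ≤ k → c k = 0)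
    (h0 : ∃ k ≤ (-2 : ℤ), c k ≠ 1) :
    rbit (∑' k : ℤ, (c k : ℝ) * (2:ℝ) ^ k) (-1) = c (-1) := by
  set f : ℤ → ℝ := fun k => (c (k - 1) : ℝ) * (2:ℝ) ^ k with hf
  have hz : (∑' k : ℤ, (c k : ℝ) * (2:ℝ) ^ k) / (2:ℝ) ^ (-1 : ℤ) = ∑' k : ℤ, f k := by
    rw [← tsum_div_const, ← (Equiv.subRight (1:ℤ)).tsum_eq]
    refine tsum_congr fun k => ?_
    simp only [Equiv.subRight_apply, hf]
    rw [mul_div_assoc, ← zpow_sub₀ two_ne_zero]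
    congr 2
    ring
  have hpos : ∀ n : ℕ, n ∉ Finset.range (B + 1) → f n = 0 := fun n hn => by
    simp only [Finset.mem_range, not_lt] at hn
    simp [hf, hB ((n:ℤ) - 1) (by omega)]
  have hneg : ∀ n : ℕ, f (-((n:ℤ) + 1)) = c (-((n:ℤ) + 1) - 1) * (1 / 2 / 2 ^ n : ℝ) := fun n => by
    simp only [hf]
    congr 1
    rw [zpow_neg, zpow_add_one₀ two_ne_zero, zpow_natCast]
    field_simp
  have hle : ∀ n : ℕ, f (-((n:ℤ) + 1)) ≤ 1 / 2 / 2 ^ n := fun n => by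
    rw [hneg]
    exact mul_le_of_le_one_left (by positivity) (by exact_mod_cast hc _)
  have hnn : ∀ n : ℕ, 0 ≤ f (-((n:ℤ) + 1)) := fun n => by simp only [hf]; positivity
  have hs : Summable fun n : ℕ => f (-((n:ℤ) + 1)) :=
    .of_nonneg_of_le hnn hle (summable_geometric_two' 1)
  have hlt : ∑' n : ℕ, f (-((n:ℤ) + 1)) < 1 := by
    rw [← tsum_geometric_two' 1]
    obtain ⟨k, hk, hck⟩ := h0
    obtain ⟨n, hn⟩ := Int.le.dest hk
    refine Summable.tsum_lt_tsum (i := n) hle ?_ hs (summable_geometric_two' 1)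
    have : c (-((n:ℤ) + 1) - 1) = 0 := by
      rw [show -((n:ℤ) + 1) - 1 = k by omega]
      have := hc k
      omega
    rw [hneg, this]
    simp only [Nat.cast_zero, zero_mul]
    positivity
  have hfin : ∑' n : ℕ, f n = ((∑ n ∈ Finset.range B, c n * 2 ^ n) * 2 + c (-1) : ℤ) := by
    rw [tsum_eq_sum hpos, Finset.sum_range_succ']
    push_cast
    rw [Finset.sum_mul]
    simp only [hf]
    congr 1
    · refine Finset.sum_congr rfl fun n _ => ?_
      rw [add_sub_cancel_right, zpow_add_one₀ two_ne_zero, zpow_natCast, mul_assoc]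
    · simp
  have hsum := tsum_of_nat_of_neg_add_one (f := f)
    (summable_of_ne_finset_zero (s := Finset.range (B + 1)) hpos) hs
  have hfloor : ⌊(∑' k : ℤ, (c k : ℝ) * (2:ℝ) ^ k) / (2:ℝ) ^ (-1 : ℤ)⌋ =
      (∑ n ∈ Finset.range B, c n * 2 ^ n) * 2 + c (-1) := by
    rw [hz, hsum, hfin, Int.floor_intCast_add, Int.floor_eq_zero_iff.2 ⟨tsum_nonneg hnn, hlt⟩,
      add_zero]
  have := hc (-1)
  rw [rbit, hfloor]
  omega

theorem eW_dprod {x y : ℝ} (hx : 0 ≤ x) (hy : 0 ≤ y)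
    (h : ∃ k ≤ (-2 : ℤ), dprodDigit x y k ≠ 1) :
    eW (dprod x y) = (-1) ^ (dprodSupport x y (-1)).ncard := by
  rw [eW, dprod, rbit_tsum_digits (B := (Int.log 2 x + Int.log 2 y + 1).toNat) _ _ h,
    dprodDigit_eq, ← neg_one_pow_eq_pow_mod_two]
  · intro k
    have := Nat.mod_lt (dprodSupport x y k).ncard two_pos
    rw [dprodDigit_eq]
    omega
  · intro k hk
    exact dprodDigit_eq_zero_of_lt hx hy (by omega)

/-- The positions at which the binary digits of `k` meet those of `t`, read in opposite
directions from the binary point. -/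
def walshSupport (k : ℕ) (t : ℝ) : Set ℕ := {i : ℕ | k / 2 ^ i % 2 = 1 ∧ rbit t (-1 - (i:ℤ)) = 1}

theorem finite_walshSupport (k : ℕ) (t : ℝ) : (walshSupport k t).Finite := by
  refine (finite_Iio k).subset fun i hi => ?_
  by_contra hik
  have : k < 2 ^ i := (not_lt.1 hik).trans_lt Nat.lt_two_pow_self
  simp [walshSupport, Nat.div_eq_of_lt this] at hi

theorem walsh_eq_ite {k : ℕ} (hk : k ≠ 0) (t : ℝ) :
    walsh k t = if k % 2 = 0 then walsh (k / 2) (2 * t) + walsh (k / 2) (2 * t - 1)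
      else walsh (k / 2) (2 * t) - walsh (k / 2) (2 * t - 1) := by
  obtain ⟨n, rfl⟩ := Nat.exists_eq_succ_of_ne_zero hk
  rw [walsh]

theorem walsh_eq_zero {k : ℕ} {t : ℝ} (ht : t ∉ Ico (0:ℝ) 1) : walsh k t = 0 := by
  induction k using Nat.strong_induction_on generalizing t with
  | _ k ih =>
    rcases eq_or_ne k 0 with rfl | hk
    · rw [walsh]
      exact if_neg ht
    · have hlt : k / 2 < k := Nat.div_lt_self (by omega) one_lt_two
      rw [walsh_eq_ite hk, ih _ hlt, ih _ hlt]
      · simp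
      all_goals
        simp only [mem_Ico, not_and_or, not_le, not_lt] at ht ⊢
        rcases ht with ht | ht
        · left; linarith
        · right; linarith

theorem rbit_two_mul_sub (t : ℝ) (b : ℤ) (i : ℕ) :
    rbit (2 * t - b) (-1 - (i:ℤ)) = rbit t (-1 - ((i + 1 : ℕ) : ℤ)) := by
  have : (2 * t - b) / (2:ℝ) ^ (-1 - (i:ℤ)) =
      t / (2:ℝ) ^ (-1 - ((i + 1 : ℕ) : ℤ)) - ((2 * (2 ^ i * b) : ℤ) : ℝ) := by
    rw [show (-1 - (i:ℤ)) = -((i + 1 : ℕ) : ℤ) by push_cast; ring,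
      show (-1 - ((i + 1 : ℕ) : ℤ)) = -((i + 2 : ℕ) : ℤ) by push_cast; ring]
    simp only [zpow_neg, zpow_natCast, div_inv_eq_mul]
    push_cast
    ring
  rw [rbit, this, Int.floor_sub_intCast, rbit, Int.sub_mul_emod_self_left]

theorem ncard_walshSupport (k : ℕ) (t : ℝ) (b : ℤ) :
    (walshSupport k t).ncard =
      (walshSupport (k / 2) (2 * t - b)).ncard + (if k % 2 = 1 then rbit t (-1) else 0) := by
  have himg : ∀ i, i + 1 ∈ walshSupport k t ↔ i ∈ walshSupport (k / 2) (2 * t - b) := fun i => by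
    simp only [walshSupport, mem_ofPred_eq, rbit_two_mul_sub, Nat.div_div_eq_div_mul, pow_succ']
  have hzero : 0 ∈ walshSupport k t ↔ k % 2 = 1 ∧ rbit t (-1) = 1 := by simp [walshSupport]
  rw [← ncard_image_of_injective (walshSupport (k / 2) (2 * t - b)) Nat.succ_injective]
  by_cases h : k % 2 = 1 ∧ rbit t (-1) = 1
  · rw [if_pos h.1, h.2, ← ncard_insert_of_notMem (a := 0) (by simp)
      ((finite_walshSupport _ _).image _)]
    congr 1
    ext (_ | i)
    · simp [hzero, h]
    · simp [himg]
  · have : (if k % 2 = 1 then rbit t (-1) else 0) = 0 := by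
      rw [rbit_eq_one_iff] at h
      split_ifs with h1
      · rw [rbit_eq_ite, if_neg fun h2 => h ⟨h1, h2⟩]
      · rfl
    rw [this, add_zero]
    congr 1
    ext (_ | i)
    · simp [hzero, h]
    · simp [himg]

theorem walsh_eq_neg_one_pow (k : ℕ) {t : ℝ} (ht : t ∈ Ico (0:ℝ) 1) :
    walsh k t = (-1) ^ (walshSupport k t).ncard := by
  induction k using Nat.strong_induction_on generalizing t with
  | _ k ih =>
    rcases eq_or_ne k 0 with rfl | hk
    · have : walshSupport 0 t = ∅ := by simp [walshSupport]
      rw [this, ncard_empty, pow_zero, walsh]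
      exact if_pos ht
    have hlt : k / 2 < k := Nat.div_lt_self (by omega) one_lt_two
    rcases lt_or_ge t (1 / 2) with h | h
    · have hb : rbit t (-1) = 0 := rbit_eq_zero_of_lt ht.1 (by norm_num; linarith)
      have h2 : walsh (k / 2) (2 * t - 1) = 0 :=
        walsh_eq_zero fun hm => by linarith [hm.1]
      rw [walsh_eq_ite hk, h2, ncard_walshSupport k t 0, hb,
        ih _ hlt ⟨by linarith [ht.1], by linarith⟩]
      simp
    · have hb : rbit t (-1) = 1 := by
        have : ⌊t / (2:ℝ) ^ (-1:ℤ)⌋ = 1 := by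
          rw [Int.floor_eq_iff]
          norm_num
          constructor <;> linarith [ht.2]
        simp only [rbit_eq_one_iff, this, Int.one_emod_two]
      have h2 : walsh (k / 2) (2 * t) = 0 :=
        walsh_eq_zero fun hm => by linarith [hm.2]
      rw [walsh_eq_ite hk, h2, ncard_walshSupport k t 1, hb,
        ih _ hlt (t := 2 * t - 1) ⟨by linarith, by linarith [ht.2]⟩]
      rcases Nat.mod_two_eq_zero_or_one k with hk2 | hk2
      · simp [hk2]
      · simp [hk2, pow_succ]

theorem rbit_div_two_pow (y : ℝ) (M : ℕ) (j : ℤ) : rbit (y / 2 ^ M) j = rbit y (j + M) := by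
  rw [rbit, rbit, zpow_add₀ two_ne_zero, zpow_natCast, div_div, mul_comm]

theorem rbit_of_mem_dyadic {x : ℝ} {k M : ℕ} (hx : x ∈ Ico ((k:ℝ) / 2 ^ M) ((k + 1) / 2 ^ M))
    (i : ℕ) : rbit x ((i:ℤ) - M) = k / 2 ^ i % 2 := by
  have h : ⌊x / (2:ℝ) ^ (-(M:ℤ))⌋ = k := by
    rw [zpow_neg, zpow_natCast, div_inv_eq_mul, Int.floor_eq_iff]
    exact ⟨by simpa using (div_le_iff₀ (by positivity)).1 hx.1,
      by simpa using (lt_div_iff₀ (by positivity)).1 hx.2⟩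
  rw [rbit, show (i:ℤ) - M = -(M:ℤ) + i by ring, floor_div_two_zpow_add, h]
  norm_cast

theorem ncard_dprodSupport_of_mem_dyadic {x y : ℝ} {k M : ℕ}
    (hx : x ∈ Ico ((k:ℝ) / 2 ^ M) ((k + 1) / 2 ^ M)) (hy0 : 0 ≤ y) (hy : y < 2 ^ M) :
    (dprodSupport x y (-1)).ncard = (walshSupport k (y / 2 ^ M)).ncard := by
  have hinj : Function.Injective fun i : ℕ => (i:ℤ) - M := fun a b h => by simpa using h
  rw [← ncard_image_of_injective (walshSupport k (y / 2 ^ M)) hinj]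
  congr 1
  have hmem : ∀ i : ℕ, (i:ℤ) - M ∈ dprodSupport x y (-1) ↔ i ∈ walshSupport k (y / 2 ^ M) :=
    fun i => by
      simp only [dprodSupport, walshSupport, mem_ofPred_eq, rbit_of_mem_dyadic hx, rbit_div_two_pow]
      rw [show (-1:ℤ) - (i - M) = -1 - i + M by ring]
  ext j
  constructor
  · intro hj
    have h1 : -1 - j < (M:ℤ) := by
      have := (le_zpow_of_rbit_eq_one hy0 hj.2).trans_lt hy
      rw [← zpow_natCast] at this
      exact (zpow_lt_zpow_iff_right₀ one_lt_two).1 this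
    obtain ⟨i, hi⟩ := Int.le.dest (show -(M:ℤ) ≤ j by omega)
    obtain rfl : j = (i:ℤ) - M := by omega
    exact ⟨i, (hmem i).1 hj, rfl⟩
  · rintro ⟨i, hi, rfl⟩
    exact (hmem i).2 hi

theorem ae_eW_dprod_eq_walsh {y : ℝ} {k M : ℕ} (hy0 : 0 < y) (hy : y < 2 ^ M) :
    ∀ᵐ x : ℝ, x ∈ Icc ((k:ℝ) / 2 ^ M) ((k + 1) / 2 ^ M) →
      eW (dprod x y) = walsh k (y / 2 ^ M) := by
  filter_upwards [(countable_setOf_dprodDigit_eq_one hy0 (-2)).ae_notMem volume,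
    Measure.ae_ne volume (((k:ℝ) + 1) / 2 ^ M)] with x hx hne hxI
  have hx0 : 0 ≤ x := le_trans (by positivity) hxI.1
  have hbad : ∃ l ≤ (-2 : ℤ), dprodDigit x y l ≠ 1 := by
    by_contra! hall
    exact hx ⟨hx0, hall⟩
  rw [eW_dprod hx0 hy0.le hbad,
    ncard_dprodSupport_of_mem_dyadic ⟨hxI.1, lt_of_le_of_ne hxI.2 hne⟩ hy0.le hy,
    walsh_eq_neg_one_pow k ⟨by positivity, (div_lt_one (by positivity)).2 hy⟩]

theorem walshTransform_indicator_dyadic {y : ℝ} {k M : ℕ} (hy0 : 0 < y) (hy : y < 2 ^ M) :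
    walshTransform ((Icc ((k:ℝ) / 2 ^ M) ((k + 1) / 2 ^ M)).indicator 1) y =
      (((2:ℝ) ^ M)⁻¹ * walsh k (y / 2 ^ M) : ℝ) := by
  set I := Icc ((k:ℝ) / 2 ^ M) (((k:ℝ) + 1) / 2 ^ M)
  have hsub : I ⊆ Ici 0 := fun x hx => le_trans (by positivity) hx.1
  have hmul : (fun x : ℝ => (eW (dprod x y) : ℂ) * I.indicator 1 x) =
      I.indicator fun x => (eW (dprod x y) : ℂ) := by
    ext x
    by_cases hx : x ∈ I <;> simp [hx]
  rw [walshTransform, hmul, setIntegral_indicator measurableSet_Icc, inter_eq_right.2 hsub,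
    setIntegral_congr_ae (g := fun _ => (walsh k (y / 2 ^ M) : ℂ)) measurableSet_Icc
      ((ae_eW_dprod_eq_walsh hy0 hy).mono fun x hx hxI => by rw [hx hxI]),
    setIntegral_const, measureReal_def, Real.volume_Icc, ← sub_div, add_sub_cancel_left,
    ENNReal.toReal_ofReal (by positivity)]
  simp

/-- If `I = [k/L^n, (k+1)/L^n] ⊆ [0,1]` with `L = 2^m` a power of two, then
`F_W(1_I)(y) = L^{-n} W_k(y / L^n)` for almost every `y ∈ [0, L^n)`. -/
theorem walshTransform_indicator_scaled (m k n : ℕ) (L : ℕ) (hL : L = 2 ^ m)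
    (hI : (k + 1 : ℝ) / (L : ℝ) ^ n ≤ 1) :
    ∀ᵐ y ∂(volume.restrict (Set.Ico (0:ℝ) ((L : ℝ) ^ n))),
      walshTransform
          ((Set.Icc ((k : ℝ) / (L : ℝ) ^ n) ((k + 1 : ℝ) / (L : ℝ) ^ n)).indicator 1) y =
        (((L : ℝ) ^ n)⁻¹ * walsh k (y / (L : ℝ) ^ n) : ℝ) := by
  have hLn : (L:ℝ) ^ n = 2 ^ (m * n) := by rw [hL]; push_cast; rw [pow_mul]
  rw [ae_restrict_iff' measurableSet_Ico, hLn]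
  filter_upwards [Measure.ae_ne volume (0:ℝ)] with y hne hy
  exact walshTransform_indicator_dyadic (lt_of_le_of_ne hy.1 hne.symm) hy.2

end
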